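/- arXiv:2207.09997 — 3 statements merged into one kernel-verified Lean document; each statement's English description precedes it below -/
import Mathlib

section
/- Let λ ∈ ℝ, let k, r be integers with k, r ≥ 0, and let f ∈ ℝ[[x]] be a formal power series. Then x^k · D^k f = Σ_{m=0}^{k} (−1)^{k−m} {k+r \brack m+r}_{r,λ} · (xD+r)_{m,λ} f. -/
open Finset PowerSeries

/-- Degenerate falling factorial `(x)_{n,λ} = x(x-λ)⋯(x-(n-1)λ)`. -/
noncomputable def dfall (lam x : ℝ) (n : ℕ) : ℝ := ∏ i ∈ Finset.range n, (x - i * lam)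

/-- Ordinary falling factorial `(x)_n = x(x-1)⋯(x-n+1)`. -/
noncomputable def ffall (x : ℝ) (n : ℕ) : ℝ := ∏ i ∈ Finset.range n, (x - i)

/-- Degenerate rising factorial `⟨x⟩_{n,λ} = x(x+λ)⋯(x+(n-1)λ)`. -/
noncomputable def drise (lam x : ℝ) (n : ℕ) : ℝ := ∏ i ∈ Finset.range n, (x + i * lam)

/-- Rising factorial `⟨x⟩_n = x(x+1)⋯(x+n-1)`. -/
noncomputable def rise (x : ℝ) (n : ℕ) : ℝ := ∏ i ∈ Finset.range n, (x + i)

/-- Formal derivative `D = d/dx` on `ℝ⟦X⟧`. -/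
noncomputable def D (f : PowerSeries ℝ) : PowerSeries ℝ := PowerSeries.derivativeFun f

/-- The operator `(xD + c)_{m,λ} = (xD+c)(xD+c-λ)⋯(xD+c-(m-1)λ)` applied to a power series,
where the factor with the largest shift is applied first. -/
noncomputable def xDFall (lam c : ℝ) : ℕ → PowerSeries ℝ → PowerSeries ℝ
  | 0, f => f
  | m + 1, f => xDFall lam c m (PowerSeries.X * D f + (c - m * lam) • f)

theorem coeff_X_mul_D (n : ℕ) (g : PowerSeries ℝ) :
    coeff n (PowerSeries.X * D g) = n * coeff n g := by
  cases n with
  | zero => simp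
  | succ n =>
    rw [coeff_succ_X_mul, Nat.cast_succ, mul_comm]
    exact coeff_derivative g n

theorem coeff_X_pow_succ_mul_D (n k : ℕ) (g : PowerSeries ℝ) :
    coeff n (PowerSeries.X ^ (k + 1) * D g) = ((n : ℝ) - k) * coeff n (PowerSeries.X ^ k * g) := by
  rw [pow_succ, mul_assoc, coeff_X_pow_mul', coeff_X_pow_mul']
  split_ifs with h
  · rw [coeff_X_mul_D, Nat.cast_sub h]
  · simp

theorem coeff_X_pow_mul_iterate_D (n k : ℕ) (f : PowerSeries ℝ) :
    coeff n (PowerSeries.X ^ k * D^[k] f) = ffall n k * coeff n f := by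
  induction k with
  | zero => simp [ffall]
  | succ k ih =>
    rw [Function.iterate_succ_apply', coeff_X_pow_succ_mul_D, ih, ffall, ffall,
      Finset.prod_range_succ]
    ring

theorem coeff_xDFall (lam c : ℝ) (n m : ℕ) (f : PowerSeries ℝ) :
    coeff n (xDFall lam c m f) = dfall lam (n + c) m * coeff n f := by
  induction m generalizing f with
  | zero => simp [xDFall, dfall]
  | succ m ih =>
    rw [xDFall, ih, map_add, coeff_X_mul_D, coeff_smul, smul_eq_mul, dfall, dfall,
      Finset.prod_range_succ]
    ring

theorem drise_neg (lam x : ℝ) (n : ℕ) : drise lam (-x) n = (-1) ^ n * dfall lam x n := by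
  induction n with
  | zero => simp [drise, dfall]
  | succ n ih =>
    simp only [drise, dfall, Finset.prod_range_succ] at ih ⊢
    rw [ih]
    ring

theorem rise_neg (x : ℝ) (n : ℕ) : rise (-x) n = (-1) ^ n * ffall x n := by
  simpa [drise, dfall, rise, ffall] using drise_neg 1 x n

/-- `x^k D^k f = Σ_{m=0}^{k} (−1)^{k−m} {k+r \brack m+r}_{r,λ} (xD+r)_{m,λ} f`. -/
theorem statement5 (lam : ℝ) (k r : ℕ) (T : ℕ → ℤ → ℝ)
    (hT : ∀ (n : ℕ) (x : ℝ),
      rise (x + r) n = ∑ j ∈ Finset.range (n + 1), T n j * drise lam x j)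
    (hT0 : ∀ (n : ℕ) (j : ℤ), j < 0 ∨ (n : ℤ) < j → T n j = 0)
    (f : PowerSeries ℝ) :
    PowerSeries.X ^ k * D^[k] f
      = ∑ m ∈ Finset.range (k + 1), ((-1 : ℝ) ^ (k - m) * T k m) • xDFall lam r m f := by
  ext n
  rw [coeff_X_pow_mul_iterate_D, map_sum]
  simp only [coeff_smul, smul_eq_mul, coeff_xDFall]
  have h := hT k (-(n + r))
  rw [show -((n : ℝ) + r) + r = -n by ring, rise_neg] at h
  have hsq (j : ℕ) : (-1 : ℝ) ^ j * (-1) ^ j = 1 := by rw [← mul_pow]; simp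
  calc ffall n k * coeff n f
      = (-1) ^ k * ((-1) ^ k * ffall n k) * coeff n f := by rw [← mul_assoc, hsq, one_mul]
    _ = _ := by
      rw [h, Finset.mul_sum, Finset.sum_mul]
      refine Finset.sum_congr rfl fun m hm => ?_
      have hmk : m ≤ k := Nat.lt_succ_iff.mp (Finset.mem_range.mp hm)
      have hk : (-1 : ℝ) ^ k = (-1) ^ (k - m) * (-1) ^ m := by
        rw [← pow_add, Nat.sub_add_cancel hmk]
      rw [drise_neg, hk]
      linear_combination
        (-1) ^ (k - m) * T k m * dfall lam (n + r) m * coeff n f * hsq m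
end

section
/- Let λ ∈ ℝ and let r ≥ 0 be an integer. For all integers k, m with k ≥ m ≥ 0, the degenerate r-Stirling numbers of the second kind satisfy {(k+1)+r \brace m+r}_{r,λ} = Σ_{l=m−1}^{k} C(k,l) (1−λ)_{k−l,λ} {l+r \brace (m−1)+r}_{r,λ} + r · Σ_{l=m}^{k} C(k,l) (−λ)_{k−l,λ} {l+r \brace m+r}_{r,λ}, where C(k,l) is the binomial coefficient, (1−λ)_{j,λ} and (−λ)_{j,λ} are degenerate falling factorials of the real numbers 1−λ and −λ, and for m = 0 the first sum is interpreted via the convention that terms {l+r \brace (m−1)+r}_{r,λ} with m−1 = −1 are 0 (so the l = −1 summand is absent). -/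
open Finset

/-- Degenerate falling factorial of an algebra element:
`(u)_{m,λ} = ∏_{i=0}^{m-1} (u - iλ·1)`, multiplied in increasing order of `i`. -/
noncomputable def algFall {A : Type*} [Ring A] [Algebra ℝ A] (lam : ℝ) (u : A) (m : ℕ) : A :=
  ((List.range m).map (fun i => u - ((i : ℝ) * lam) • (1 : A))).prod

theorem dfall_succ (lam x : ℝ) (n : ℕ) :
    dfall lam x (n + 1) = dfall lam x n * (x - n * lam) :=
  Finset.prod_range_succ _ _

theorem dfall_succ' (lam x : ℝ) (n : ℕ) :
    dfall lam x (n + 1) = x * dfall lam (x - lam) n := by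
  rw [dfall, Finset.prod_range_succ', mul_comm, dfall]
  congr 1
  · simp
  · refine Finset.prod_congr rfl fun i _ => ?_
    push_cast
    ring

theorem ffall_succ' (x : ℝ) (n : ℕ) : ffall x (n + 1) = x * ffall (x - 1) n := by
  rw [ffall, Finset.prod_range_succ', mul_comm, ffall]
  congr 1
  · simp
  · refine Finset.prod_congr rfl fun i _ => ?_
    push_cast
    ring

theorem ffall_natCast_eq_zero {j i : ℕ} (h : j < i) : ffall (j : ℝ) i = 0 :=
  Finset.prod_eq_zero (Finset.mem_range.2 h) (sub_self _)

theorem ffall_natCast_self_ne_zero (j : ℕ) : ffall (j : ℝ) j ≠ 0 := by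
  refine Finset.prod_ne_zero_iff.2 fun i hi => sub_ne_zero.2 ?_
  exact_mod_cast (Finset.mem_range.1 hi).ne'

/-- The Vandermonde convolution for degenerate falling factorials. -/
theorem dfall_add (lam a b : ℝ) (n : ℕ) :
    dfall lam (a + b) n
      = ∑ l ∈ Finset.range (n + 1), (n.choose l : ℝ) * (dfall lam a l * dfall lam b (n - l)) := by
  rw [← Finset.Nat.sum_antidiagonal_eq_sum_range_succ
    (fun i j => (n.choose i : ℝ) * (dfall lam a i * dfall lam b j))]
  induction n with
  | zero => simp [dfall]
  | succ n ih =>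
    rw [Finset.sum_antidiagonal_choose_succ_mul (fun i j => dfall lam a i * dfall lam b j),
      dfall_succ, ih, Finset.sum_mul, ← Finset.sum_add_distrib]
    refine Finset.sum_congr rfl fun p hp => ?_
    have hp' : p.1 + p.2 = n := Finset.HasAntidiagonal.mem_antidiagonal.1 hp
    have hc : n.choose p.2 = n.choose p.1 := (Nat.choose_symm_of_eq_add hp'.symm).symm
    have hn : (n : ℝ) = p.1 + p.2 := by exact_mod_cast hp'.symm
    rw [hc, dfall_succ, dfall_succ, hn]
    ring

/-- The falling factorials are linearly independent as functions on `ℝ`. -/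
theorem eq_of_sum_mul_ffall_eq {N : ℕ} {c d : ℕ → ℝ}
    (h : ∀ x : ℝ, ∑ j ∈ Finset.range N, c j * ffall x j = ∑ j ∈ Finset.range N, d j * ffall x j)
    {j : ℕ} (hj : j < N) : c j = d j := by
  induction j using Nat.strong_induction_on with
  | _ j ih =>
    have hx := h j
    rw [← sub_eq_zero, ← Finset.sum_sub_distrib, Finset.sum_eq_single j] at hx
    · rw [← sub_mul] at hx
      exact sub_eq_zero.1 ((mul_eq_zero.1 hx).resolve_right (ffall_natCast_self_ne_zero j))
    · intro i hi hij
      rcases lt_or_gt_of_ne hij with hlt | hgt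
      · rw [ih i hlt (hlt.trans hj), sub_self]
      · rw [ffall_natCast_eq_zero hgt, mul_zero, mul_zero, sub_self]
    · intro hn
      exact absurd (Finset.mem_range.2 hj) hn

/-- the recurrence
`{k+1+r \brace m+r}_{r,λ} = Σ_{l=m−1}^{k} C(k,l)(1−λ)_{k−l,λ}{l+r \brace m−1+r}_{r,λ}
 + r Σ_{l=m}^{k} C(k,l)(−λ)_{k−l,λ}{l+r \brace m+r}_{r,λ}` for `k ≥ m ≥ 0`
(for `m = 0` every term of the first sum carries the index `m−1 = −1` and hence vanishes). -/
theorem statement11 (lam : ℝ) (r : ℕ) (S : ℕ → ℤ → ℝ)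
    (hS : ∀ (n : ℕ) (x : ℝ),
      dfall lam (x + r) n = ∑ k ∈ Finset.range (n + 1), S n k * ffall x k)
    (hS0 : ∀ (n : ℕ) (k : ℤ), k < 0 ∨ (n : ℤ) < k → S n k = 0)
    (k m : ℕ) (hmk : m ≤ k) :
    S (k + 1) m
      = (∑ l ∈ Finset.Icc (m - 1) k,
          (k.choose l : ℝ) * dfall lam (1 - lam) (k - l) * S l ((m : ℤ) - 1))
        + r * ∑ l ∈ Finset.Icc m k,
            (k.choose l : ℝ) * dfall lam (-lam) (k - l) * S l m := by
  have expand (n N : ℕ) (hN : n + 1 ≤ N) (x : ℝ) :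
      dfall lam (x + r) n = ∑ j ∈ Finset.range N, S n j * ffall x j := by
    rw [hS]
    refine Finset.sum_subset (Finset.range_mono hN) fun j _ hj => ?_
    rw [hS0 n j (Or.inr (by simp only [Finset.mem_range] at hj; omega)), zero_mul]
  have expand_shift (n N : ℕ) (hN : n + 1 ≤ N) (x : ℝ) :
      x * dfall lam (x - 1 + r) n
        = ∑ j ∈ Finset.range (N + 1), S n ((j : ℤ) - 1) * ffall x j := by
    rw [expand n N hN, Finset.sum_range_succ', hS0 n _ (Or.inl (by simp)), zero_mul, add_zero,
      Finset.mul_sum]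
    refine Finset.sum_congr rfl fun j _ => ?_
    rw [ffall_succ', Nat.cast_succ, add_sub_cancel_right]
    ring
  have restrict (a : ℕ) (c : ℕ → ℝ) (i : ℤ) (ha : ∀ l < a, S l i = 0) :
      ∑ l ∈ Finset.Icc a k, c l * S l i = ∑ l ∈ Finset.range (k + 1), c l * S l i := by
    refine Finset.sum_subset (fun l hl => ?_) fun l hl hl' => ?_
    · simp only [Finset.mem_Icc, Finset.mem_range] at *
      omega
    · simp only [Finset.mem_Icc, Finset.mem_range] at *
      rw [ha l (by omega), mul_zero]
  rw [restrict (m - 1) _ _ fun l hl => hS0 _ _ (Or.inr (by omega)),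
    restrict m _ _ fun l hl => hS0 _ _ (Or.inr (by omega))]
  refine eq_of_sum_mul_ffall_eq (N := k + 2) (c := fun j => S (k + 1) j)
    (d := fun j => (∑ l ∈ Finset.range (k + 1),
          (k.choose l : ℝ) * dfall lam (1 - lam) (k - l) * S l ((j : ℤ) - 1))
        + r * ∑ l ∈ Finset.range (k + 1),
            (k.choose l : ℝ) * dfall lam (-lam) (k - l) * S l j) (fun x => ?_) (by omega)
  have first : x * dfall lam (x + r - lam) k = ∑ j ∈ Finset.range (k + 2),
      (∑ l ∈ Finset.range (k + 1),
        (k.choose l : ℝ) * dfall lam (1 - lam) (k - l) * S l ((j : ℤ) - 1)) * ffall x j := by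
    simp only [Finset.sum_mul]
    rw [show x + r - lam = (x - 1 + r) + (1 - lam) by ring, dfall_add, Finset.mul_sum,
      Finset.sum_comm]
    refine Finset.sum_congr rfl fun l hl => ?_
    simp only [mul_assoc, ← Finset.mul_sum]
    rw [← expand_shift l (k + 1) (Finset.mem_range.1 hl)]
    ring
  have second : dfall lam (x + r - lam) k = ∑ j ∈ Finset.range (k + 2),
      (∑ l ∈ Finset.range (k + 1),
        (k.choose l : ℝ) * dfall lam (-lam) (k - l) * S l j) * ffall x j := by
    simp only [Finset.sum_mul]
    rw [sub_eq_add_neg, dfall_add, Finset.sum_comm]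
    refine Finset.sum_congr rfl fun l hl => ?_
    simp only [mul_assoc, ← Finset.mul_sum]
    rw [← expand l (k + 2) (by have := Finset.mem_range.1 hl; omega)]
    ring
  simp only [add_mul, Finset.sum_add_distrib, mul_assoc (r : ℝ), ← Finset.mul_sum]
  rw [← first, ← second, ← expand (k + 1) (k + 2) le_rfl, dfall_succ']
  ring
end

section
/- Let A be an associative unital ℝ-algebra containing elements a and a⁺ with a·a⁺ − a⁺·a = 1, let λ ∈ ℝ, and let k, r be integers with k, r ≥ 0. Then a⁺a · (a⁺a + r − 1)_{k,λ} = a⁺ · (a⁺a + r)_{k,λ} · a in A. -/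
open Finset

/-- Semiconjugation passes to degenerate falling factorials. -/
theorem SemiconjBy.algFall {A : Type*} [Ring A] [Algebra ℝ A] {x u v : A}
    (h : SemiconjBy x u v) (lam : ℝ) (m : ℕ) :
    SemiconjBy x (algFall lam u m) (algFall lam v m) := by
  induction m with
  | zero => simp [_root_.algFall]
  | succ m ih =>
    simp only [_root_.algFall, List.range_succ, List.bind_eq_flatMap, List.pure_def,
      List.flatMap_append, List.flatMap_singleton, List.map_append, List.prod_append,
      List.map_singleton, List.prod_singleton] at ih ⊢
    refine ih.mul_right (h.sub_right ?_)
    simp [SemiconjBy]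

/-- `a⁺a · (a⁺a+r−1)_{k,λ} = a⁺ · (a⁺a+r)_{k,λ} · a`. -/
theorem statement12 {A : Type*} [Ring A] [Algebra ℝ A] (a ad : A)
    (hcomm : a * ad - ad * a = 1) (lam : ℝ) (k r : ℕ) :
    ad * a * algFall lam (ad * a + (r : A) - 1) k
      = ad * algFall lam (ad * a + (r : A)) k * a := by
  have h : SemiconjBy a (ad * a + (r : A) - 1) (ad * a + (r : A)) := by
    have hr : a * (r : A) = r * a := (Nat.cast_commute r a).symm.eq
    have hN : a * (ad * a) = ad * a * a + a := by
      rw [← mul_assoc, sub_eq_iff_eq_add.mp hcomm, add_mul, one_mul, add_comm]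
    rw [SemiconjBy, mul_sub, mul_add, add_mul, hr, hN, mul_one]
    abel
  rw [mul_assoc, (h.algFall lam k).eq, mul_assoc]
end
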